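/- Let α > 0, β > 0 and κ be real numbers with 0 ≤ κ ≤ 1. For every ξ ∈ [0, 2π], every eigenvalue of the Hermitian positive semidefinite matrix G(ξ)*G(ξ) (where G(ξ)* is the conjugate transpose of G(ξ)) is at most 1 if and only if β ≤ min{2κα, 1/(2α)}. -/

import Mathlib

open Real Matrix

/-- The amplification matrix `G(ξ)` with `ω₁ = 4αβ sin²(ξ/2)` and `ω₂ = β sin ξ`. -/
noncomputable def ampG (α β κ ξ : ℝ) : Matrix (Fin 2) (Fin 2) ℂ :=
  !![((1 - 4*α*β*(Real.sin (ξ/2))^2 : ℝ) : ℂ), -Complex.I * ((β * Real.sin ξ : ℝ) : ℂ);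
     -Complex.I * ((β * Real.sin ξ : ℝ) : ℂ), ((1 - κ*(4*α*β*(Real.sin (ξ/2))^2) : ℝ) : ℂ)]

theorem mem_spectrum_ampG_iff (α β κ ξ : ℝ) (μ : ℂ) :
    μ ∈ spectrum ℂ ((ampG α β κ ξ)ᴴ * ampG α β κ ξ) ↔
      ((((1 - 4*α*β*(Real.sin (ξ/2))^2)^2 + (β * Real.sin ξ)^2 : ℝ) : ℂ) - μ) *
        ((((1 - κ*(4*α*β*(Real.sin (ξ/2))^2))^2 + (β * Real.sin ξ)^2 : ℝ) : ℂ) - μ) =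
      (((β * Real.sin ξ * ((1 - κ) * (4*α*β*(Real.sin (ξ/2))^2)))^2 : ℝ) : ℂ) := by
  rw [spectrum.mem_iff, Matrix.isUnit_iff_isUnit_det, isUnit_iff_ne_zero, not_not,
    Matrix.det_fin_two, ← sub_eq_zero (b := (((_ : ℝ)) : ℂ))]
  simp only [ampG, Matrix.algebraMap_matrix_apply, Matrix.sub_apply, Matrix.mul_apply,
    Fin.sum_univ_two, Matrix.conjTranspose_apply, Matrix.of_apply, Matrix.cons_val', Matrix.cons_val_zero,
    Matrix.cons_val_one, Matrix.cons_val_fin_one, Complex.star_def, map_mul, map_neg,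
    Complex.conj_ofReal, Complex.conj_I, neg_neg]
  generalize Real.sin (ξ/2) = s
  generalize Real.sin ξ = w
  push_cast
  simp only [Algebra.algebraMap_self, RingHom.id_apply, zero_sub]
  have hI : Complex.I^2 = -1 := Complex.I_sq
  have hI4 : Complex.I^4 = 1 := Complex.I_pow_four
  ring_nf
  simp only [hI, hI4]
  ring_nf

theorem re_le_one_of_quadratic {A B c : ℝ} (hA : A ≤ 1) (hB : B ≤ 1)
    (hc : c ≤ (1 - A) * (1 - B)) {μ : ℂ} (h : ((A : ℂ) - μ) * ((B : ℂ) - μ) = (c : ℂ)) :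
    μ.re ≤ 1 := by
  have hre := congrArg Complex.re h
  have him := congrArg Complex.im h
  simp only [Complex.mul_re, Complex.mul_im, Complex.sub_re, Complex.sub_im,
    Complex.ofReal_re, Complex.ofReal_im] at hre him
  by_contra! hμ
  have h0 : μ.im = 0 := by
    have : μ.im * (2 * μ.re - A - B) = 0 := by linarith
    rcases mul_eq_zero.mp this with h | h
    · exact h
    · linarith
  rw [h0] at hre
  nlinarith [mul_nonneg (sub_nonneg.2 hA) (sub_nonneg.2 hB)]

theorem exists_root_quadratic_ge {A B c : ℝ} (hc : 0 ≤ c) :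
    ∃ x : ℝ, A ≤ x ∧ B ≤ x ∧ (A - x) * (B - x) = c := by
  have hs : 0 ≤ (A - B)^2 + 4 * c := by positivity
  have hsq := Real.sq_sqrt hs
  have habs : |A - B| ≤ √((A - B)^2 + 4 * c) := Real.abs_le_sqrt (by linarith)
  obtain ⟨h1, h2⟩ := abs_le.mp habs
  refine ⟨(A + B + √((A - B)^2 + 4 * c)) / 2, by linarith, by linarith, ?_⟩
  nlinarith

theorem diag_le_one_of_spectrum {α β κ ξ : ℝ}
    (h : ∀ μ ∈ spectrum ℂ ((ampG α β κ ξ)ᴴ * ampG α β κ ξ), μ.re ≤ 1) :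
    (1 - 4*α*β*(Real.sin (ξ/2))^2)^2 + (β * Real.sin ξ)^2 ≤ 1 ∧
      (1 - κ*(4*α*β*(Real.sin (ξ/2))^2))^2 + (β * Real.sin ξ)^2 ≤ 1 := by
  obtain ⟨x, hA, hB, hx⟩ := exists_root_quadratic_ge
    (A := (1 - 4*α*β*(Real.sin (ξ/2))^2)^2 + (β * Real.sin ξ)^2)
    (B := (1 - κ*(4*α*β*(Real.sin (ξ/2))^2))^2 + (β * Real.sin ξ)^2)
    (sq_nonneg (β * Real.sin ξ * ((1 - κ) * (4*α*β*(Real.sin (ξ/2))^2))))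
  have hx1 := h (x : ℂ) ((mem_spectrum_ampG_iff ..).2 (by exact_mod_cast hx))
  rw [Complex.ofReal_re] at hx1
  exact ⟨hA.trans hx1, hB.trans hx1⟩

theorem sin_sq_eq_half_angle (ξ : ℝ) :
    Real.sin ξ ^ 2 = 4 * (Real.sin (ξ/2))^2 * (1 - (Real.sin (ξ/2))^2) := by
  have h : Real.sin ξ = 2 * Real.sin (ξ/2) * Real.cos (ξ/2) := by
    rw [← Real.sin_two_mul]; congr 1; ring
  rw [h, mul_pow, Real.cos_sq']; ring

theorem amplification_bounds {α β κ s : ℝ} (hα : 0 < α) (hβ : 0 < β) (hκ0 : 0 ≤ κ)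
    (hκ1 : κ ≤ 1) (h1 : β ≤ 2*κ*α) (h2 : 2*α*β ≤ 1) (hs0 : 0 ≤ s) (hs1 : s ≤ 1) :
    0 ≤ α*(2 - 4*α*β*s) - β*(1 - s) ∧ 0 ≤ κ*α*(2 - 4*κ*α*β*s) - β*(1 - s) ∧
      4*β^2*s*(1 - s)*(1 - κ)^2*α^2 ≤
        (α*(2 - 4*α*β*s) - β*(1 - s)) * (κ*α*(2 - 4*κ*α*β*s) - β*(1 - s)) := by
  have ht : 0 ≤ 1 - s := by linarith
  have hκ' : 0 ≤ 1 - κ := by linarith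
  have hκα : 0 ≤ κ * α := by positivity
  have hp0 : 2*α*(1 - κ) ≤ 2*α - β := by linarith
  have hp0' : 0 ≤ 2*α - β := le_trans (by positivity) hp0
  have hq0 : 0 ≤ 2*κ*α - β := by linarith
  have hX : 0 ≤ 2*α*β := by positivity
  have hκX : κ*(2*α*β) ≤ 1 := mul_le_one₀ hκ1 hX h2
  have hp1 : 0 ≤ 2*α*(1 - 2*α*β) := mul_nonneg (by positivity) (by linarith)
  have hq1 : 0 ≤ 2*κ*α*(1 - κ*(2*α*β)) := mul_nonneg (by positivity) (by linarith)
  have hp : α*(2 - 4*α*β*s) - β*(1 - s) = (1-s)*(2*α - β) + s*(2*α*(1 - 2*α*β)) := by ring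
  have hq : κ*α*(2 - 4*κ*α*β*s) - β*(1 - s)
      = (1-s)*(2*κ*α - β) + s*(2*κ*α*(1 - κ*(2*α*β))) := by ring
  have hcross : 4*β^2*(1 - κ)^2*α^2 ≤ (2*α - β) * (2*κ*α*(1 - κ*(2*α*β))) := by
    have hX' : 2*α*β*(1 - κ) ≤ 1 - κ*(2*α*β) := by linarith
    calc 4*β^2*(1 - κ)^2*α^2 = (2*α*(1 - κ)) * (β*(2*α*β*(1 - κ))) := by ring
      _ ≤ (2*α - β) * (2*κ*α*(1 - κ*(2*α*β))) := by gcongr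
  rw [hp, hq]
  refine ⟨by positivity, by positivity, ?_⟩
  have hm := mul_le_mul_of_nonneg_left hcross (mul_nonneg hs0 ht)
  have e1 := mul_nonneg (mul_nonneg ht ht) (mul_nonneg hp0' hq0)
  have e2 := mul_nonneg (mul_nonneg hs0 ht) (mul_nonneg hp1 hq0)
  have e3 := mul_nonneg (mul_nonneg hs0 hs0) (mul_nonneg hp1 hq1)
  linarith

theorem stmt3 (α β κ : ℝ) (hα : 0 < α) (hβ : 0 < β) (hκ0 : 0 ≤ κ) (hκ1 : κ ≤ 1) :
    (∀ ξ ∈ Set.Icc (0:ℝ) (2*π),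
        ∀ μ ∈ spectrum ℂ ((ampG α β κ ξ)ᴴ * ampG α β κ ξ), μ.re ≤ 1) ↔
      β ≤ min (2*κ*α) (1/(2*α)) := by
  rw [le_min_iff, le_div_iff₀ (by positivity)]
  constructor
  · intro h
    constructor
    · by_contra! hlt
      -- A small positive value of `sin² (ξ/2)` violates the bound on the second diagonal entry.
      obtain ⟨s, hs0, hs⟩ : ∃ s, 0 < s ∧ β * s < β - 2*κ*α := by
        refine ⟨(β - 2*κ*α) / (2*β), div_pos (by linarith) (by positivity), ?_⟩
        have : β * ((β - 2*κ*α) / (2*β)) = (β - 2*κ*α) / 2 := by field_simp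
        linarith
      have hκα : 0 ≤ κ * α := by positivity
      have hs1 : s ≤ 1 := by nlinarith
      have hξ : 2 * Real.arcsin √s ∈ Set.Icc (0:ℝ) (2*π) := by
        constructor
        · have := Real.arcsin_nonneg.2 (Real.sqrt_nonneg s)
          linarith
        · have := Real.arcsin_le_pi_div_two √s
          linarith [Real.pi_pos]
      have hB := (diag_le_one_of_spectrum (h _ hξ)).2
      rw [mul_pow, sin_sq_eq_half_angle (2 * Real.arcsin √s), mul_div_cancel_left₀ _ two_ne_zero,
        Real.sin_arcsin (by linarith [Real.sqrt_nonneg s]) (Real.sqrt_le_one.2 hs1),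
        Real.sq_sqrt hs0.le] at hB
      have hβs : 0 < 4*β*s := by positivity
      have hq : 0 ≤ 4*β*s*(κ*α*(2 - 4*κ*α*β*s) - β*(1 - s)) := by linarith
      have hq' := nonneg_of_mul_nonneg_right hq hβs
      have : 0 ≤ (κ*α)^2*(4*β*s) := by positivity
      linarith
    · have hA := (diag_le_one_of_spectrum
        (h π ⟨Real.pi_pos.le, by linarith [Real.pi_pos]⟩)).1
      rw [Real.sin_pi, Real.sin_pi_div_two] at hA
      have hαβ : 0 < α * β := by positivity
      nlinarith
  · rintro ⟨h1, h2⟩ ξ - μ hμ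
    have hs0 := sq_nonneg (Real.sin (ξ/2))
    have hs1 := Real.sin_sq_le_one (ξ/2)
    obtain ⟨hp, hq, hpq⟩ :=
      amplification_bounds hα hβ hκ0 hκ1 h1 (by linarith) hs0 hs1
    rw [mem_spectrum_ampG_iff] at hμ
    have hβs : 0 ≤ 4*β*(Real.sin (ξ/2))^2 := by positivity
    have hp' := mul_nonneg hβs hp
    have hq' := mul_nonneg hβs hq
    have hpq' := mul_le_mul_of_nonneg_left hpq (mul_nonneg hβs hβs)
    refine re_le_one_of_quadratic ?_ ?_ ?_ hμ <;>
      simp only [mul_pow, sin_sq_eq_half_angle ξ] <;> linarith
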